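/- Let ν > 0 and ε ∈ ℝ. Let w : ℝ × [0,∞) → ℂ be twice continuously differentiable and f : ℝ²₊ → ℂ be such that: (i) Δw − iε w = f in ℝ²₊; (ii) −∂_{x₂}w(x₁,0) = ν w(x₁,0) for every x₁ ∈ ℝ; (iii) for every x₁ ∈ ℝ the function x₂ ↦ w(x₁,x₂)e^{−νx₂} is integrable on (0,∞) with ∫₀^∞ w(x₁,x₂)e^{−νx₂} dx₂ = 0; (iv) the integrals ∫_{ℝ²₊} |∇w|² dx, ∫_{ℝ²₊} (1+x₂)^{−2}|w|² dx, ∫_ℝ |w(x₁,0)|² dx₁, and ∫_{ℝ²₊} (1+x₂)²|f|² dx are finite. Then ∫_{ℝ²₊} |∇w|² dx ≤ −2 Re ∫_{ℝ²₊} f · conj(w) dx. -/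

import Mathlib

open Set MeasureTheory

/-- First partial derivative of a function on the closed half-plane `ℝ × [0,∞)`. -/
noncomputable def pd1 (f : ℝ × ℝ → ℂ) (q : ℝ × ℝ) : ℂ :=
  deriv (fun s : ℝ => f (s, q.2)) q.1

/-- Second partial derivative (one-sided at the boundary) of a function on `ℝ × [0,∞)`. -/
noncomputable def pd2 (f : ℝ × ℝ → ℂ) (q : ℝ × ℝ) : ℂ :=
  derivWithin (fun t : ℝ => f (q.1, t)) (Ici (0 : ℝ)) q.2

/-- The open upper half-plane `ℝ²₊ = {x₂ > 0}`. -/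
def upperHalf : Set (ℝ × ℝ) := {p : ℝ × ℝ | 0 < p.2}

open Filter Topology

section PartialDerivatives

variable {g : ℝ × ℝ → ℂ} {p : ℝ × ℝ}

lemma closedHalf_eq_prod : {p : ℝ × ℝ | 0 ≤ p.2} = univ ×ˢ Ici (0 : ℝ) := by
  ext p; simp

lemma uniqueDiffOn_closedHalf : UniqueDiffOn ℝ {p : ℝ × ℝ | 0 ≤ p.2} := by
  rw [closedHalf_eq_prod]
  exact uniqueDiffOn_univ.prod (uniqueDiffOn_Ici 0)

lemma isOpen_upperHalf : IsOpen upperHalf := isOpen_lt continuous_const continuous_snd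

lemma upperHalf_subset_closedHalf : upperHalf ⊆ {p : ℝ × ℝ | 0 ≤ p.2} :=
  fun p (h : 0 < p.2) => (h.le : 0 ≤ p.2)

lemma closedHalf_mem_nhds (hp : p ∈ upperHalf) : {p : ℝ × ℝ | 0 ≤ p.2} ∈ 𝓝 p :=
  mem_of_superset (isOpen_upperHalf.mem_nhds hp) upperHalf_subset_closedHalf

lemma hasDerivAt_fst_fderivWithin (hg : DifferentiableOn ℝ g {p : ℝ × ℝ | 0 ≤ p.2})
    (hp : 0 ≤ p.2) :
    HasDerivAt (fun s : ℝ => g (s, p.2))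
      (fderivWithin ℝ g {p : ℝ × ℝ | 0 ≤ p.2} p (1, 0)) p.1 := by
  have h := (hg p hp).hasFDerivWithinAt
  have hc : HasDerivWithinAt (fun s : ℝ => (s, p.2)) ((1 : ℝ), (0 : ℝ)) univ p.1 :=
    ((hasDerivAt_id p.1).prodMk (hasDerivAt_const p.1 p.2)).hasDerivWithinAt
  exact (h.comp_hasDerivWithinAt_of_eq p.1 hc (fun s _ => hp) rfl).hasDerivAt univ_mem

lemma hasDerivWithinAt_snd_fderivWithin (hg : DifferentiableOn ℝ g {p : ℝ × ℝ | 0 ≤ p.2})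
    (hp : 0 ≤ p.2) :
    HasDerivWithinAt (fun t : ℝ => g (p.1, t))
      (fderivWithin ℝ g {p : ℝ × ℝ | 0 ≤ p.2} p (0, 1)) (Ici 0) p.2 := by
  have h := (hg p hp).hasFDerivWithinAt
  have hc : HasDerivWithinAt (fun t : ℝ => (p.1, t)) ((0 : ℝ), (1 : ℝ)) (Ici 0) p.2 :=
    ((hasDerivAt_const p.2 p.1).prodMk (hasDerivAt_id p.2)).hasDerivWithinAt
  exact h.comp_hasDerivWithinAt_of_eq p.2 hc (fun s hs => hs) rfl

lemma pd1_eq_fderivWithin (hg : DifferentiableOn ℝ g {p : ℝ × ℝ | 0 ≤ p.2}) (hp : 0 ≤ p.2) :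
    pd1 g p = fderivWithin ℝ g {p : ℝ × ℝ | 0 ≤ p.2} p (1, 0) :=
  (hasDerivAt_fst_fderivWithin hg hp).deriv

lemma pd2_eq_fderivWithin (hg : DifferentiableOn ℝ g {p : ℝ × ℝ | 0 ≤ p.2}) (hp : 0 ≤ p.2) :
    pd2 g p = fderivWithin ℝ g {p : ℝ × ℝ | 0 ≤ p.2} p (0, 1) :=
  (hasDerivWithinAt_snd_fderivWithin hg hp).derivWithin (uniqueDiffOn_Ici 0 _ hp)

lemma hasDerivAt_pd1 (hg : DifferentiableOn ℝ g {p : ℝ × ℝ | 0 ≤ p.2}) (hp : 0 ≤ p.2) :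
    HasDerivAt (fun s : ℝ => g (s, p.2)) (pd1 g p) p.1 :=
  pd1_eq_fderivWithin hg hp ▸ hasDerivAt_fst_fderivWithin hg hp

lemma hasDerivAt_pd2 (hg : DifferentiableOn ℝ g {p : ℝ × ℝ | 0 ≤ p.2}) (hp : 0 < p.2) :
    HasDerivAt (fun t : ℝ => g (p.1, t)) (pd2 g p) p.2 :=
  (pd2_eq_fderivWithin hg hp.le ▸ hasDerivWithinAt_snd_fderivWithin hg hp.le).hasDerivAt
    (Ici_mem_nhds hp)

lemma ContDiffOn.pd1 {m n : WithTop ℕ∞} (hg : ContDiffOn ℝ n g {p : ℝ × ℝ | 0 ≤ p.2})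
    (hmn : m + 1 ≤ n) : ContDiffOn ℝ m (pd1 g) {p : ℝ × ℝ | 0 ≤ p.2} := by
  have hd : DifferentiableOn ℝ g {p : ℝ × ℝ | 0 ≤ p.2} :=
    (hg.of_le (le_trans (by simp) hmn)).differentiableOn one_ne_zero
  exact ((hg.fderivWithin uniqueDiffOn_closedHalf hmn).clm_apply contDiffOn_const).congr
    fun p hp => pd1_eq_fderivWithin hd hp

lemma ContDiffOn.pd2 {m n : WithTop ℕ∞} (hg : ContDiffOn ℝ n g {p : ℝ × ℝ | 0 ≤ p.2})
    (hmn : m + 1 ≤ n) : ContDiffOn ℝ m (pd2 g) {p : ℝ × ℝ | 0 ≤ p.2} := by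
  have hd : DifferentiableOn ℝ g {p : ℝ × ℝ | 0 ≤ p.2} :=
    (hg.of_le (le_trans (by simp) hmn)).differentiableOn one_ne_zero
  exact ((hg.fderivWithin uniqueDiffOn_closedHalf hmn).clm_apply contDiffOn_const).congr
    fun p hp => pd2_eq_fderivWithin hd hp

end PartialDerivatives

section FDerivCoordinates

variable {F : ℝ × ℝ → ℝ} {F' : ℝ × ℝ →L[ℝ] ℝ} {p : ℝ × ℝ} {d : ℝ}

lemma HasFDerivAt.apply_one_zero_eq (hF : HasFDerivAt F F' p)
    (hd : HasDerivAt (fun s => F (s, p.2)) d p.1) : F' (1, 0) = d :=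
  (hF.comp_hasDerivAt_of_eq p.1 ((hasDerivAt_id p.1).prodMk (hasDerivAt_const p.1 p.2))
    rfl).unique hd

lemma HasFDerivAt.apply_zero_one_eq (hF : HasFDerivAt F F' p)
    (hd : HasDerivAt (fun t => F (p.1, t)) d p.2) : F' (0, 1) = d :=
  (hF.comp_hasDerivAt_of_eq p.2 ((hasDerivAt_const p.2 p.1).prodMk (hasDerivAt_id p.2))
    rfl).unique hd

end FDerivCoordinates

/-- Trace estimate on a half-line for functions orthogonal to `e^{-νt}`. -/
lemma two_mul_norm_sq_le_integral_of_orthogonal_exp {ν : ℝ} (hν : 0 < ν) {u v : ℝ → ℂ}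
    (hu0 : ContinuousWithinAt u (Ici 0) 0) (huv : ∀ t ∈ Ioi (0 : ℝ), HasDerivAt u (v t) t)
    (hv : ContinuousOn v (Ioi 0)) (hv2 : IntegrableOn (fun t => ‖v t‖ ^ 2) (Ioi 0))
    (hint : IntegrableOn (fun t : ℝ => u t * Complex.exp (-(ν : ℂ) * t)) (Ioi (0 : ℝ)))
    (horth : ∫ t in Ioi (0 : ℝ), u t * Complex.exp (-(ν : ℂ) * t) = 0) :
    2 * ν * ‖u 0‖ ^ 2 ≤ ∫ t in Ioi (0 : ℝ), ‖v t‖ ^ 2 := by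
  have hnorm (t : ℝ) : ‖Complex.exp (-(ν : ℂ) * t)‖ = Real.exp (-ν * t) := by
    rw [Complex.norm_exp]; simp
  have hsq (t : ℝ) : Real.exp (-ν * t) ^ 2 = Real.exp (-(2 * ν) * t) := by
    rw [← Real.exp_nat_mul]; congr 1; push_cast; ring
  have hexp2 : IntegrableOn (fun t : ℝ => Real.exp (-ν * t) ^ 2) (Ioi 0) := by
    simp_rw [hsq]
    exact integrableOn_exp_mul_Ioi (by linarith) 0
  have hexp2_val : ∫ t in Ioi (0 : ℝ), Real.exp (-ν * t) ^ 2 = 1 / (2 * ν) := by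
    simp_rw [hsq]
    rw [integral_exp_mul_Ioi (by linarith) 0]
    simp
  have hvexp : IntegrableOn (fun t : ℝ => v t * Complex.exp (-(ν : ℂ) * t)) (Ioi 0) := by
    refine (hv2.add hexp2).mono' ?_ (Eventually.of_forall fun t => ?_)
    · exact (hv.mul (by fun_prop)).aestronglyMeasurable measurableSet_Ioi
    · simp only [norm_mul, hnorm, Pi.add_apply]
      nlinarith [sq_nonneg (‖v t‖ - Real.exp (-ν * t)), sq_nonneg (‖v t‖),
        sq_nonneg (Real.exp (-ν * t))]
  have hderiv : ∀ t ∈ Ioi (0 : ℝ),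
      HasDerivAt (fun t : ℝ => u t * Complex.exp (-(ν : ℂ) * t))
        (v t * Complex.exp (-(ν : ℂ) * t) - ν * (u t * Complex.exp (-(ν : ℂ) * t))) t := by
    intro t ht
    have h1 : HasDerivAt (fun t : ℝ => -(ν : ℂ) * t) (-(ν : ℂ)) t := by
      simpa using (Complex.ofRealCLM.hasDerivAt (x := t)).const_mul (-(ν : ℂ))
    refine ((huv t ht).mul h1.cexp).congr_deriv ?_
    ring
  have hdint := hvexp.sub (hint.const_mul (ν : ℂ))
  have hlim := tendsto_zero_of_hasDerivAt_of_integrableOn_Ioi hderiv hdint hint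
  have hcont : ContinuousWithinAt (fun t : ℝ => u t * Complex.exp (-(ν : ℂ) * t)) (Ici 0) 0 :=
    hu0.mul (by fun_prop)
  have hu : ∫ t in Ioi (0 : ℝ), v t * Complex.exp (-(ν : ℂ) * t) = -u 0 := by
    have h := integral_Ioi_of_hasDerivAt_of_tendsto hcont hderiv hdint hlim
    rw [integral_sub hvexp (hint.const_mul (ν : ℂ)), integral_const_mul, horth] at h
    simpa using h
  have hle : ‖u 0‖ ≤ ∫ t in Ioi (0 : ℝ), ‖v t‖ * Real.exp (-ν * t) := by
    rw [← norm_neg, ← hu]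
    refine (norm_integral_le_integral_norm _).trans_eq ?_
    simp only [norm_mul, hnorm]
  have hvexp' : IntegrableOn (fun t : ℝ => ‖v t‖ * Real.exp (-ν * t)) (Ioi 0) := by
    simpa only [IntegrableOn, norm_mul, hnorm] using hvexp.norm
  have hmono : ∫ t in Ioi (0 : ℝ), (4 * ν * ‖u 0‖ * (‖v t‖ * Real.exp (-ν * t))
      - 4 * ν ^ 2 * ‖u 0‖ ^ 2 * Real.exp (-ν * t) ^ 2) ≤ ∫ t in Ioi (0 : ℝ), ‖v t‖ ^ 2 := by
    refine integral_mono ((hvexp'.const_mul _).sub (hexp2.const_mul _)) hv2 fun t => ?_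
    dsimp only
    nlinarith [sq_nonneg (‖v t‖ - 2 * ν * ‖u 0‖ * Real.exp (-ν * t))]
  rw [integral_sub (hvexp'.const_mul _) (hexp2.const_mul _), integral_const_mul,
    integral_const_mul, hexp2_val] at hmono
  have h4 : 4 * ν ^ 2 * ‖u 0‖ ^ 2 * (1 / (2 * ν)) = 2 * ν * ‖u 0‖ ^ 2 := by
    field_simp; ring
  have h5 := mul_le_mul_of_nonneg_left hle (by positivity : 0 ≤ 4 * ν * ‖u 0‖)
  nlinarith

section Divergence

/-- The weight vanishing on the lateral and top sides of `(-R, R) × (0, R)`. -/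
noncomputable def sideCutoff (R : ℝ) (p : ℝ × ℝ) : ℝ := (1 - p.1 ^ 2 / R ^ 2) * (1 - p.2 / R)

/-- The divergence of `sideCutoff R • (V₁, V₂)`, where `D` is the divergence of `(V₁, V₂)`. -/
noncomputable def sideCutoffDiv (R : ℝ) (V₁ V₂ D : ℝ × ℝ → ℝ) (p : ℝ × ℝ) : ℝ :=
  sideCutoff R p * D p - 2 * p.1 / R ^ 2 * (1 - p.2 / R) * V₁ p
    - 1 / R * (1 - p.1 ^ 2 / R ^ 2) * V₂ p

variable {V₁ V₂ D : ℝ × ℝ → ℝ} {R : ℝ}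

lemma differentiable_sideCutoff : Differentiable ℝ (sideCutoff R) := by
  unfold sideCutoff; fun_prop

lemma fderiv_sideCutoff_apply_one_zero (p : ℝ × ℝ) :
    fderiv ℝ (sideCutoff R) p (1, 0) = -(2 * p.1 / R ^ 2 * (1 - p.2 / R)) := by
  refine (differentiable_sideCutoff p).hasFDerivAt.apply_one_zero_eq ?_
  refine (((((hasDerivAt_id p.1).pow 2).div_const (R ^ 2)).const_sub 1).mul_const
    (1 - p.2 / R)).congr_deriv ?_
  simp

lemma fderiv_sideCutoff_apply_zero_one (p : ℝ × ℝ) :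
    fderiv ℝ (sideCutoff R) p (0, 1) = -(1 / R * (1 - p.1 ^ 2 / R ^ 2)) := by
  refine (differentiable_sideCutoff p).hasFDerivAt.apply_zero_one_eq ?_
  refine ((((hasDerivAt_id p.2).div_const R).const_sub 1).const_mul
    (1 - p.1 ^ 2 / R ^ 2)).congr_deriv ?_
  ring

lemma rect_subset_upperHalf : Ioo (-R) R ×ˢ Ioo 0 R ⊆ upperHalf := fun _ hp => hp.2.1

lemma setIntegral_sideCutoffDiv (hR : 0 < R)
    (hV₁ : ContinuousOn V₁ {p : ℝ × ℝ | 0 ≤ p.2}) (hV₂ : ContinuousOn V₂ {p : ℝ × ℝ | 0 ≤ p.2})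
    (hd₁ : ∀ p ∈ upperHalf, DifferentiableAt ℝ V₁ p)
    (hd₂ : ∀ p ∈ upperHalf, DifferentiableAt ℝ V₂ p)
    (hD : ∀ p ∈ upperHalf, fderiv ℝ V₁ p (1, 0) + fderiv ℝ V₂ p (0, 1) = D p)
    (hi : IntegrableOn (sideCutoffDiv R V₁ V₂ D) (Ioo (-R) R ×ˢ Ioo 0 R)) :
    ∫ p in Ioo (-R) R ×ˢ Ioo 0 R, sideCutoffDiv R V₁ V₂ D p
      = ∫ x in (-R)..R, (1 - x ^ 2 / R ^ 2) * -V₂ (x, 0) := by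
  have hae : (Ioo (-R) R ×ˢ Ioo 0 R : Set (ℝ × ℝ)) =ᵐ[volume] Icc (-R, 0) (R, R) := by
    rw [← Icc_prod_Icc]
    exact Measure.set_prod_ae_eq Ioo_ae_eq_Icc Ioo_ae_eq_Icc
  have hsub : Icc (-R, 0) (R, R) ⊆ {p : ℝ × ℝ | 0 ≤ p.2} := fun p hp => hp.1.2
  have hc : Continuous (sideCutoff R) := differentiable_sideCutoff.continuous
  have heq : EqOn (sideCutoffDiv R V₁ V₂ D)
      (fun p => (sideCutoff R p • fderiv ℝ V₁ p + V₁ p • fderiv ℝ (sideCutoff R) p) (1, 0)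
        + (sideCutoff R p • fderiv ℝ V₂ p + V₂ p • fderiv ℝ (sideCutoff R) p) (0, 1))
      (Ioo (-R) R ×ˢ Ioo 0 R) := fun p hp => by
    simp only [sideCutoffDiv, ← hD p (rect_subset_upperHalf hp), add_apply,
      smul_apply, smul_eq_mul, fderiv_sideCutoff_apply_one_zero,
      fderiv_sideCutoff_apply_zero_one]
    ring
  have hmeas : MeasurableSet (Ioo (-R) R ×ˢ Ioo 0 R : Set (ℝ × ℝ)) :=
    measurableSet_Ioo.prod measurableSet_Ioo
  have hi' := (hi.congr_fun heq hmeas).congr_set_ae hae.symm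
  have hgreen := integral_divergence_prod_Icc_of_hasFDerivAt_of_le
    (fun p => sideCutoff R p * V₁ p) (fun p => sideCutoff R p * V₂ p) _ _ (-R, 0) (R, R)
    ⟨by linarith, hR.le⟩ (hc.continuousOn.mul (hV₁.mono hsub)) (hc.continuousOn.mul (hV₂.mono hsub))
    (fun p hp => (differentiable_sideCutoff p).hasFDerivAt.mul
      (hd₁ p (rect_subset_upperHalf hp)).hasFDerivAt)
    (fun p hp => (differentiable_sideCutoff p).hasFDerivAt.mul
      (hd₂ p (rect_subset_upperHalf hp)).hasFDerivAt) hi'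
  rw [setIntegral_congr_fun hmeas heq, setIntegral_congr_set hae, hgreen]
  simp [sideCutoff, hR.ne']

lemma abs_sideCutoffDiv_le (hR : 1 ≤ R) {p : ℝ × ℝ} (hp : p ∈ Ioo (-R) R ×ˢ Ioo 0 R) :
    |sideCutoffDiv R V₁ V₂ D p| ≤
      |D p| + 4 * ((1 + p.2)⁻¹ * |V₁ p|) + 2 * ((1 + p.2)⁻¹ * |V₂ p|) := by
  obtain ⟨⟨h1, h2⟩, h3, h4⟩ := hp
  have hR0 : 0 < R := by linarith
  have ha : |1 - p.1 ^ 2 / R ^ 2| ≤ 1 := by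
    have : p.1 ^ 2 / R ^ 2 ≤ 1 := by
      rw [div_le_one (by positivity)]; nlinarith
    have : 0 ≤ p.1 ^ 2 / R ^ 2 := by positivity
    rw [abs_le]; constructor <;> linarith
  have hb : |1 - p.2 / R| ≤ 1 := by
    have : p.2 / R ≤ 1 := (div_le_one hR0).2 h4.le
    have : 0 ≤ p.2 / R := by positivity
    rw [abs_le]; constructor <;> linarith
  have hRinv : 1 / R ≤ 2 * (1 + p.2)⁻¹ := by
    rw [← div_eq_mul_inv, div_le_div_iff₀ hR0 (by linarith)]; linarith
  have hx : |2 * p.1 / R ^ 2| ≤ 4 * (1 + p.2)⁻¹ := by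
    have : |2 * p.1 / R ^ 2| ≤ 2 * (1 / R) := by
      rw [abs_div, abs_of_pos (by positivity : 0 < R ^ 2), abs_mul, abs_two,
        div_le_iff₀ (by positivity)]
      have : |p.1| ≤ R := abs_le.2 ⟨h1.le, h2.le⟩
      field_simp
      nlinarith
    linarith
  have hinv : 0 ≤ (1 + p.2)⁻¹ := by positivity
  have t1 : |sideCutoff R p * D p| ≤ |D p| := by
    rw [sideCutoff, abs_mul, abs_mul]
    exact mul_le_of_le_one_left (abs_nonneg _) (mul_le_one₀ ha (abs_nonneg _) hb)
  have t2 : |2 * p.1 / R ^ 2 * (1 - p.2 / R) * V₁ p| ≤ 4 * ((1 + p.2)⁻¹ * |V₁ p|) := by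
    rw [abs_mul, abs_mul, ← mul_assoc]
    refine mul_le_mul_of_nonneg_right ?_ (abs_nonneg _)
    simpa only [mul_one] using mul_le_mul hx hb (abs_nonneg _) (by positivity)
  have t3 : |1 / R * (1 - p.1 ^ 2 / R ^ 2) * V₂ p| ≤ 2 * ((1 + p.2)⁻¹ * |V₂ p|) := by
    rw [abs_mul, abs_mul, ← mul_assoc, abs_of_pos (by positivity : 0 < 1 / R)]
    refine mul_le_mul_of_nonneg_right ?_ (abs_nonneg _)
    simpa only [mul_one] using mul_le_mul hRinv ha (abs_nonneg _) (by positivity)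
  exact (abs_sub _ _).trans (add_le_add ((abs_sub _ _).trans (add_le_add t1 t2)) t3)

lemma tendsto_sideCutoffDiv (p : ℝ × ℝ) :
    Tendsto (fun R => sideCutoffDiv R V₁ V₂ D p) atTop (𝓝 (D p)) := by
  have hsq : Tendsto (fun R : ℝ => R ^ 2) atTop atTop := tendsto_pow_atTop two_ne_zero
  have h1 : Tendsto (fun R : ℝ => 1 - p.1 ^ 2 / R ^ 2) atTop (𝓝 (1 - 0)) :=
    tendsto_const_nhds.sub (tendsto_const_nhds.div_atTop hsq)
  have h2 : Tendsto (fun R : ℝ => 1 - p.2 / R) atTop (𝓝 (1 - 0)) :=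
    tendsto_const_nhds.sub (tendsto_const_nhds.div_atTop tendsto_id)
  have h3 : Tendsto (fun R : ℝ => 2 * p.1 / R ^ 2) atTop (𝓝 0) :=
    tendsto_const_nhds.div_atTop hsq
  have h4 : Tendsto (fun R : ℝ => 1 / R) atTop (𝓝 0) := tendsto_const_nhds.div_atTop tendsto_id
  simpa [sideCutoffDiv, sideCutoff] using
    ((((h1.mul h2).mul_const (D p)).sub ((h3.mul h2).mul_const (V₁ p))).sub
      ((h4.mul h1).mul_const (V₂ p)))

/-- Divergence inequality on the half-plane for fields that are integrable against `(1 + x₂)⁻¹` and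
point out of the half-plane along its boundary. -/
lemma setIntegral_upperHalf_divergence_le
    (hV₁ : ContinuousOn V₁ {p : ℝ × ℝ | 0 ≤ p.2}) (hV₂ : ContinuousOn V₂ {p : ℝ × ℝ | 0 ≤ p.2})
    (hd₁ : ∀ p ∈ upperHalf, DifferentiableAt ℝ V₁ p)
    (hd₂ : ∀ p ∈ upperHalf, DifferentiableAt ℝ V₂ p)
    (hD : ∀ p ∈ upperHalf, fderiv ℝ V₁ p (1, 0) + fderiv ℝ V₂ p (0, 1) = D p)
    (hDi : IntegrableOn D upperHalf)
    (hi₁ : IntegrableOn (fun p => (1 + p.2)⁻¹ * |V₁ p|) upperHalf)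
    (hi₂ : IntegrableOn (fun p => (1 + p.2)⁻¹ * |V₂ p|) upperHalf)
    (hb : ∀ x, V₂ (x, 0) ≤ 0) (hbi : Integrable fun x => -V₂ (x, 0)) :
    ∫ p in upperHalf, D p ≤ ∫ x, -V₂ (x, 0) := by
  let S : ℕ → Set (ℝ × ℝ) := fun n => Ioo (-((n : ℝ) + 1)) (n + 1) ×ˢ Ioo 0 ((n : ℝ) + 1)
  have hS (n : ℕ) : MeasurableSet (S n) := measurableSet_Ioo.prod measurableSet_Ioo
  have hSsub (n : ℕ) : S n ⊆ upperHalf := rect_subset_upperHalf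
  have hR (n : ℕ) : (1 : ℝ) ≤ n + 1 := by simp
  have hbound := (hDi.abs.add (hi₁.const_mul 4)).add (hi₂.const_mul 2)
  have hm (n : ℕ) : AEStronglyMeasurable (sideCutoffDiv (n + 1) V₁ V₂ D)
      (volume.restrict upperHalf) := by
    have m₁ := (hV₁.mono upperHalf_subset_closedHalf).aestronglyMeasurable
      isOpen_upperHalf.measurableSet (μ := volume)
    have m₂ := (hV₂.mono upperHalf_subset_closedHalf).aestronglyMeasurable
      isOpen_upperHalf.measurableSet (μ := volume)
    have hc (c : ℝ × ℝ → ℝ) (h : Continuous c) :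
        AEStronglyMeasurable c (volume.restrict upperHalf) := h.aestronglyMeasurable
    exact (((hc _ differentiable_sideCutoff.continuous).mul hDi.aestronglyMeasurable).sub
      ((hc _ (by fun_prop)).mul m₁)).sub ((hc _ (by fun_prop)).mul m₂)
  have hSi (n : ℕ) : IntegrableOn (sideCutoffDiv (n + 1) V₁ V₂ D) (S n) := by
    refine Integrable.mono' (hbound.mono_measure (Measure.restrict_mono (hSsub n) le_rfl))
      ((hm n).mono_measure (Measure.restrict_mono (hSsub n) le_rfl)) ?_
    exact (ae_restrict_iff' (hS n)).2 (Eventually.of_forall fun p hp =>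
      abs_sideCutoffDiv_le (hR n) hp)
  have hlim : Tendsto (fun n => ∫ p in upperHalf,
      (S n).indicator (sideCutoffDiv (n + 1) V₁ V₂ D) p) atTop (𝓝 (∫ p in upperHalf, D p)) := by
    refine tendsto_integral_of_dominated_convergence _ (fun n => (hm n).indicator (hS n)) hbound
      (fun n => ?_) ?_
    · refine (ae_restrict_iff' isOpen_upperHalf.measurableSet).2 (Eventually.of_forall
        fun p hp => ?_)
      by_cases hpS : p ∈ S n
      · rw [indicator_of_mem hpS]
        exact abs_sideCutoffDiv_le (hR n) hpS
      · rw [indicator_of_notMem hpS, norm_zero]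
        have : 0 ≤ (1 + p.2)⁻¹ := inv_nonneg.2 (by linarith [show 0 < p.2 from hp])
        simp only [Pi.add_apply]
        positivity
    · refine (ae_restrict_iff' isOpen_upperHalf.measurableSet).2 (Eventually.of_forall
        fun p hp => ?_)
      have hn : Tendsto (fun n : ℕ => (n : ℝ) + 1) atTop atTop :=
        tendsto_atTop_add_const_right _ _ tendsto_natCast_atTop_atTop
      refine ((tendsto_sideCutoffDiv (V₁ := V₁) (V₂ := V₂) p).comp hn).congr' ?_
      filter_upwards [hn.eventually_gt_atTop |p.1|, hn.eventually_gt_atTop p.2] with n h1 h2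
      have hpS : p ∈ S n := ⟨abs_lt.1 h1, hp, h2⟩
      rw [indicator_of_mem hpS]
      rfl
  refine le_of_tendsto' hlim fun n => ?_
  rw [setIntegral_indicator (hS n), inter_eq_right.2 (hSsub n),
    setIntegral_sideCutoffDiv (by positivity) hV₁ hV₂ hd₁ hd₂ hD (hSi n),
    intervalIntegral.integral_of_le (by linarith [hR n])]
  refine le_trans (integral_mono_of_nonneg ?_ hbi.integrableOn ?_)
    (setIntegral_le_integral hbi (Eventually.of_forall fun x => neg_nonneg.2 (hb x)))
  · refine (ae_restrict_iff' measurableSet_Ioc).2 (Eventually.of_forall fun x hx => ?_)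
    refine mul_nonneg (sub_nonneg.2 ((div_le_one (by positivity)).2 ?_)) (neg_nonneg.2 (hb x))
    nlinarith [hx.1, hx.2]
  · refine Eventually.of_forall fun x => mul_le_of_le_one_left (neg_nonneg.2 (hb x)) ?_
    have : 0 ≤ x ^ 2 / ((n : ℝ) + 1) ^ 2 := by positivity
    linarith

end Divergence

section HalfPlane

variable {w : ℝ × ℝ → ℂ}

lemma volume_restrict_upperHalf :
    (volume : Measure (ℝ × ℝ)).restrict upperHalf = volume.prod (volume.restrict (Ioi 0)) := by
  have : upperHalf = univ ×ˢ Ioi (0 : ℝ) := by ext p; simp [upperHalf]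
  rw [this, Measure.volume_eq_prod, ← Measure.prod_restrict, Measure.restrict_univ]


/-- Integrated trace estimate: each fibre of `w` is orthogonal to `e^{-νt}`. -/
lemma two_mul_integral_trace_le {ν : ℝ} (hν : 0 < ν)
    (hw : ContDiffOn ℝ 2 w {p : ℝ × ℝ | 0 ≤ p.2})
    (horth : ∀ x₁ : ℝ,
      IntegrableOn (fun t : ℝ => w (x₁, t) * Complex.exp (-(ν : ℂ) * t)) (Ioi (0 : ℝ)) ∧
      ∫ t in Ioi (0 : ℝ), w (x₁, t) * Complex.exp (-(ν : ℂ) * t) = 0)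
    (h2 : IntegrableOn (fun p => ‖pd2 w p‖ ^ 2) upperHalf) :
    2 * ∫ x, ν * ‖w (x, 0)‖ ^ 2 ≤ ∫ p in upperHalf, ‖pd2 w p‖ ^ 2 := by
  have hd := hw.differentiableOn two_ne_zero
  have hc2 : ContinuousOn (pd2 w) {p : ℝ × ℝ | 0 ≤ p.2} :=
    (hw.pd2 (m := 1) (by norm_num)).continuousOn
  rw [IntegrableOn, volume_restrict_upperHalf] at h2
  rw [volume_restrict_upperHalf, integral_prod _ h2, ← integral_const_mul]
  refine integral_mono_of_nonneg (Eventually.of_forall fun x => by positivity)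
    h2.integral_prod_left ?_
  filter_upwards [h2.prod_right_ae] with x hx
  have hcurve : Continuous fun t : ℝ => (x, t) := by fun_prop
  rw [← mul_assoc]
  refine two_mul_norm_sq_le_integral_of_orthogonal_exp hν (u := fun t => w (x, t))
    ?_ (fun t ht => hasDerivAt_pd2 (p := (x, t)) hd ht) ?_ hx (horth x).1 (horth x).2
  · exact (hw.continuousOn.comp (s := Ici 0) hcurve.continuousOn fun t ht => ht) 0 self_mem_Ici
  · exact hc2.comp (s := Ioi 0) hcurve.continuousOn fun t ht => le_of_lt (α := ℝ) ht

end HalfPlane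

/-- Energy estimate for the projected part of the solution: if `Δw − iεw = f` in `ℝ²₊`,
`−∂₂w = νw` on `{x₂ = 0}`, each fibre of `w` is orthogonal to `e^{−νx₂}`, and the listed
integrals are finite, then `∫_{ℝ²₊} |∇w|² ≤ −2 Re ∫_{ℝ²₊} f conj(w)`. -/
theorem projected_energy_estimate (ν ε : ℝ) (hν : 0 < ν) (w f : ℝ × ℝ → ℂ)
    (hw : ContDiffOn ℝ 2 w {p : ℝ × ℝ | 0 ≤ p.2})
    (heq : ∀ p ∈ upperHalf, pd1 (pd1 w) p + pd2 (pd2 w) p - Complex.I * ε * w p = f p)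
    (hbc : ∀ x₁ : ℝ, -pd2 w (x₁, 0) = ν * w (x₁, 0))
    (horth : ∀ x₁ : ℝ,
      IntegrableOn (fun t : ℝ => w (x₁, t) * Complex.exp (-(ν : ℂ) * t)) (Ioi (0 : ℝ)) ∧
      ∫ t in Ioi (0 : ℝ), w (x₁, t) * Complex.exp (-(ν : ℂ) * t) = 0)
    (hgrad : IntegrableOn (fun p : ℝ × ℝ => ‖pd1 w p‖ ^ 2 + ‖pd2 w p‖ ^ 2) upperHalf)
    (hwL2 : IntegrableOn (fun p : ℝ × ℝ => ((1 + p.2) ^ 2)⁻¹ * ‖w p‖ ^ 2) upperHalf)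
    (htrace : Integrable (fun x₁ : ℝ => ‖w (x₁, 0)‖ ^ 2))
    (hfL2 : IntegrableOn (fun p : ℝ × ℝ => (1 + p.2) ^ 2 * ‖f p‖ ^ 2) upperHalf) :
    ∫ p in upperHalf, (‖pd1 w p‖ ^ 2 + ‖pd2 w p‖ ^ 2) ≤
      -2 * (∫ p in upperHalf, f p * (starRingEnd ℂ) (w p)).re := by
  have hd := hw.differentiableOn two_ne_zero
  have hw1 : ContDiffOn ℝ 1 (pd1 w) {p : ℝ × ℝ | 0 ≤ p.2} := hw.pd1 (by norm_num)
  have hw2 : ContDiffOn ℝ 1 (pd2 w) {p : ℝ × ℝ | 0 ≤ p.2} := hw.pd2 (by norm_num)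
  have hd1 := hw1.differentiableOn one_ne_zero
  have hd2 := hw2.differentiableOn one_ne_zero
  have hw11 : ContDiffOn ℝ 0 (pd1 (pd1 w)) {p : ℝ × ℝ | 0 ≤ p.2} := hw1.pd1 (by simp)
  have hw22 : ContDiffOn ℝ 0 (pd2 (pd2 w)) {p : ℝ × ℝ | 0 ≤ p.2} := hw2.pd2 (by simp)
  have hmeas {E : Type} [TopologicalSpace E] [TopologicalSpace.PseudoMetrizableSpace E]
      [SecondCountableTopology E] {g : ℝ × ℝ → E}
      (hg : ContinuousOn g {p : ℝ × ℝ | 0 ≤ p.2}) :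
      AEStronglyMeasurable g (volume.restrict upperHalf) :=
    (hg.mono upperHalf_subset_closedHalf).aestronglyMeasurable isOpen_upperHalf.measurableSet
  have hmf : AEStronglyMeasurable f (volume.restrict upperHalf) := by
    refine (hmeas ((hw11.continuousOn.add hw22.continuousOn).sub
      (hw.continuousOn.const_mul (Complex.I * ε)))).congr ?_
    exact (ae_restrict_iff' isOpen_upperHalf.measurableSet).2 (Eventually.of_forall heq)
  have hweight {p : ℝ × ℝ} (hp : p ∈ upperHalf) : 0 < 1 + p.2 := by
    linarith [show 0 < p.2 from hp]
  have hfw : IntegrableOn (fun p => f p * (starRingEnd ℂ) (w p)) upperHalf := by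
    refine Integrable.mono' (hwL2.add hfL2)
      (hmf.mul (hmeas (Complex.continuous_conj.comp_continuousOn hw.continuousOn)))
      ((ae_restrict_iff' isOpen_upperHalf.measurableSet).2 (Eventually.of_forall fun p hp => ?_))
    have h0 := hweight hp
    have h1 : ‖f p‖ * ‖w p‖ = ((1 + p.2) * ‖f p‖) * ((1 + p.2)⁻¹ * ‖w p‖) := by
      field_simp
    simp only [norm_mul, RCLike.norm_conj, Pi.add_apply]
    rw [h1, ← inv_pow, ← mul_pow, ← mul_pow]
    nlinarith [sq_nonneg ((1 + p.2) * ‖f p‖ - (1 + p.2)⁻¹ * ‖w p‖),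
      sq_nonneg ((1 + p.2) * ‖f p‖), sq_nonneg ((1 + p.2)⁻¹ * ‖w p‖)]
  have hfw_re : IntegrableOn (fun p => (f p * (starRingEnd ℂ) (w p)).re) upperHalf := hfw.re
  have hinner (a b : ℂ) : inner ℝ a b = (b * (starRingEnd ℂ) a).re := by
    rw [Complex.inner, mul_comm]
  have hflux {v : ℝ × ℝ → ℂ} (hv : ContinuousOn v {p : ℝ × ℝ | 0 ≤ p.2})
      (hle : ∀ p, ‖v p‖ ^ 2 ≤ ‖pd1 w p‖ ^ 2 + ‖pd2 w p‖ ^ 2) :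
      IntegrableOn (fun p => (1 + p.2)⁻¹ * |inner ℝ (w p) (v p)|) upperHalf := by
    refine Integrable.mono' (hwL2.add hgrad) ?_
      ((ae_restrict_iff' isOpen_upperHalf.measurableSet).2 (Eventually.of_forall fun p hp => ?_))
    · refine AEStronglyMeasurable.mul ?_ (hmeas (hw.continuousOn.inner (𝕜 := ℝ) hv).abs)
      exact (by fun_prop : Measurable fun p : ℝ × ℝ => (1 + p.2)⁻¹).aestronglyMeasurable
    · have h0 := inv_pos.2 (hweight hp)
      rw [Real.norm_of_nonneg (by positivity), Pi.add_apply, ← inv_pow, ← mul_pow]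
      have h1 := mul_le_mul_of_nonneg_left (abs_real_inner_le_norm (w p) (v p)) h0.le
      nlinarith [sq_nonneg ((1 + p.2)⁻¹ * ‖w p‖ - ‖v p‖), hle p,
        sq_nonneg ((1 + p.2)⁻¹ * ‖w p‖), sq_nonneg (‖v p‖)]
  have hbdry (x : ℝ) : -inner ℝ (w (x, 0)) (pd2 w (x, 0)) = ν * ‖w (x, 0)‖ ^ 2 := by
    rw [← inner_neg_right, hbc, ← Complex.real_smul, real_inner_smul_right,
      real_inner_self_eq_norm_sq]
  have hDA {g : ℝ × ℝ → ℂ} (hg : DifferentiableOn ℝ g {p : ℝ × ℝ | 0 ≤ p.2}) {p : ℝ × ℝ}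
      (hp : p ∈ upperHalf) : DifferentiableAt ℝ g p := hg.differentiableAt (closedHalf_mem_nhds hp)
  have hdiv : ∀ p ∈ upperHalf,
      fderiv ℝ (fun p => inner ℝ (w p) (pd1 w p)) p (1, 0)
        + fderiv ℝ (fun p => inner ℝ (w p) (pd2 w p)) p (0, 1)
        = ‖pd1 w p‖ ^ 2 + ‖pd2 w p‖ ^ 2 + (f p * (starRingEnd ℂ) (w p)).re := by
    intro p hp
    have hp0 : 0 < p.2 := hp
    rw [((hDA hd hp).inner ℝ (hDA hd1 hp)).hasFDerivAt.apply_one_zero_eq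
        ((hasDerivAt_pd1 hd hp0.le).inner ℝ (hasDerivAt_pd1 hd1 hp0.le)),
      ((hDA hd hp).inner ℝ (hDA hd2 hp)).hasFDerivAt.apply_zero_one_eq
        ((hasDerivAt_pd2 hd hp0).inner ℝ (hasDerivAt_pd2 hd2 hp0)),
      ← heq p hp, ← hinner]
    have hskew : inner ℝ (w p) (Complex.I * ε * w p) = 0 := by
      rw [Complex.inner]; simp; ring
    simp only [Prod.mk.eta, inner_sub_right, inner_add_right, hskew, real_inner_self_eq_norm_sq]
    ring
  have henergy := setIntegral_upperHalf_divergence_le (hw.continuousOn.inner (𝕜 := ℝ) hw1.continuousOn)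
    (hw.continuousOn.inner (𝕜 := ℝ) hw2.continuousOn) (fun p hp => (hDA hd hp).inner ℝ (hDA hd1 hp))
    (fun p hp => (hDA hd hp).inner ℝ (hDA hd2 hp)) hdiv (hgrad.add hfw_re)
    (hflux hw1.continuousOn fun p => le_add_of_nonneg_right (sq_nonneg _))
    (hflux hw2.continuousOn fun p => le_add_of_nonneg_left (sq_nonneg _))
    (fun x => by rw [← neg_nonneg, hbdry]; positivity)
    (by simpa only [hbdry] using htrace.const_mul ν)
  have h2i : IntegrableOn (fun p => ‖pd2 w p‖ ^ 2) upperHalf :=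
    Integrable.mono' hgrad (hmeas (hw2.continuousOn.norm.pow 2)) (Eventually.of_forall fun p => by
      rw [Real.norm_of_nonneg (sq_nonneg _)]
      exact le_add_of_nonneg_left (sq_nonneg _))
  have h2le : ∫ p in upperHalf, ‖pd2 w p‖ ^ 2
      ≤ ∫ p in upperHalf, (‖pd1 w p‖ ^ 2 + ‖pd2 w p‖ ^ 2) :=
    integral_mono h2i hgrad fun p => le_add_of_nonneg_left (sq_nonneg _)
  have hre : ∫ p in upperHalf, (f p * (starRingEnd ℂ) (w p)).re
      = (∫ p in upperHalf, f p * (starRingEnd ℂ) (w p)).re := integral_re hfw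
  simp only [hbdry] at henergy
  rw [integral_add hgrad hfw_re] at henergy
  have htr := two_mul_integral_trace_le hν hw horth h2i
  linarith
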